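/- Fix ℓ ∈ ℕ and κ > 0. For each N let H_N^{(1)}, …, H_N^{(ℓ)} be random N×N real symmetric matrices defined on a common probability space, with arbitrary joint dependence between them. Assume that for each i ∈ {1,…,ℓ} the sequence (H_N^{(i)})_N satisfies: (W) there are probability measures μ_N^{(i)} on ℝ, all supported in one common compact set, with W₁(E[μ̂_{H_N^{(i)}}], μ_N^{(i)}) ≤ N^{−κ}, each μ_N^{(i)} having a density on (−κ, κ) bounded by κ^{−1}|x|^{−1+κ} for |x| < κ; (L) there exists ε₀ > 0 such that for every ζ > 0 there is c_ζ > 0 with: for every Lipschitz f : ℝ → ℝ and every δ > 0, P(|(1/N) Tr f(H_N^{(i)}) − (1/N) E[Tr f(H_N^{(i)})]| > δ) ≤ exp(−(c_ζ/N^ζ)·min{(Nδ/‖f‖_Lip)², (Nδ/‖f‖_Lip)^{1+ε₀}}); and for every ε > 0, lim_{N→∞} P(H_N^{(i)} has no eigenvalues in [−e^{−N^ε}, e^{−N^ε}]) = 1. Then lim_{N→∞} ( (1/N) log E[∏_{i=1}^ℓ |det H_N^{(i)}|] − Σ_{i=1}^ℓ ∫_ℝ log|λ| μ_N^{(i)}(dλ)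 ) = 0. -/

import Mathlib

open MeasureTheory ProbabilityTheory Real Filter
open scoped ENNReal

/-- The eigenvalues of a real symmetric matrix (junk value `0` if not symmetric). -/
noncomputable def eigs {N : ℕ} (M : Matrix (Fin N) (Fin N) ℝ) : Fin N → ℝ :=
  if h : M.IsHermitian then h.eigenvalues else 0

/-- The empirical spectral measure `μ̂_M = (1/N) Σ_i δ_{λ_i(M)}`. -/
noncomputable def empSpec {N : ℕ} (M : Matrix (Fin N) (Fin N) ℝ) : Measure ℝ :=
  ((N : ℝ≥0∞))⁻¹ • ∑ i : Fin N, Measure.dirac (eigs M i)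

/-- The mean empirical spectral measure `E[μ̂_H]`, i.e. `A ↦ E[μ̂_H(A)]`. -/
noncomputable def meanSpec {Ω : Type*} [MeasurableSpace Ω] (P : Measure Ω) {N : ℕ}
    (H : Ω → Matrix (Fin N) (Fin N) ℝ) : Measure ℝ :=
  P.bind fun ω => empSpec (H ω)

/-- The Wasserstein-1 distance between two measures on `ℝ`. -/
noncomputable def W1 (μ ν : Measure ℝ) : ℝ :=
  sSup {r : ℝ | ∃ f : ℝ → ℝ, (∀ x y, |f x - f y| ≤ |x - y|) ∧
    r = |(∫ x, f x ∂μ) - ∫ x, f x ∂ν|}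

section Spectral

variable {N : ℕ}

lemma eigs_eq {M : Matrix (Fin N) (Fin N) ℝ} (hM : M.IsHermitian) :
    eigs M = hM.eigenvalues := dif_pos hM

lemma det_eq_prod_eigs {M : Matrix (Fin N) (Fin N) ℝ} (hM : M.IsHermitian) :
    M.det = ∏ a, eigs M a := by
  rw [eigs_eq hM, hM.det_eq_prod_eigenvalues]
  rfl

lemma sum_polynomial_eval_eigs {M : Matrix (Fin N) (Fin N) ℝ} (hM : M.IsHermitian)
    (p : Polynomial ℝ) : ∑ a, p.eval (eigs M a) = (Polynomial.aeval M p).trace := by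
  have key : Polynomial.aeval M p = Unitary.conjStarAlgAut ℝ _ hM.eigenvectorUnitary
      (Matrix.diagonal fun a => p.eval (hM.eigenvalues a)) := by
    have hdiag : Polynomial.aeval (Matrix.diagonal hM.eigenvalues) p
        = Matrix.diagonal fun a => p.eval (hM.eigenvalues a) := by
      have h := Polynomial.aeval_algHom_apply (Matrix.diagonalAlgHom ℝ (n := Fin N) (α := ℝ))
        hM.eigenvalues p
      simp only [Matrix.diagonalAlgHom_apply] at h
      rw [h]
      congr 1
      ext a
      have h2 := Polynomial.aeval_algHom_apply (Pi.evalAlgHom ℝ (fun _ : Fin N => ℝ) a)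
        hM.eigenvalues p
      simp only [Pi.evalAlgHom_apply] at h2
      rw [← h2, Polynomial.coe_aeval_eq_eval]
    have hspec := hM.spectral_theorem
    conv_lhs => rw [hspec]
    have h := Polynomial.aeval_algHom_apply
      ((Unitary.conjStarAlgAut ℝ _ hM.eigenvectorUnitary).toAlgEquiv.toAlgHom)
      (Matrix.diagonal hM.eigenvalues) p
    rw [hdiag] at h
    exact h
  rw [key, Unitary.conjStarAlgAut_apply, Matrix.trace_mul_comm, ← mul_assoc]
  simp [eigs_eq hM, Matrix.trace_diagonal]

variable {Ω : Type*} [MeasurableSpace Ω] {H : Ω → Matrix (Fin N) (Fin N) ℝ}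

lemma measurable_aeval_entry (hmeas : ∀ a b, Measurable fun ω => H ω a b)
    (p : Polynomial ℝ) (a b : Fin N) :
    Measurable fun ω => Polynomial.aeval (H ω) p a b := by
  have hpow : ∀ n : ℕ, ∀ a b, Measurable fun ω => (H ω ^ n) a b := by
    intro n
    induction n with
    | zero => intro a b; simp
    | succ n ih =>
      intro a b
      simp only [pow_succ, Matrix.mul_apply]
      exact Finset.measurable_sum _ fun c _ => (ih a c).mul (hmeas c b)
  simp only [Polynomial.aeval_eq_sum_range, Matrix.sum_apply, Matrix.smul_apply, smul_eq_mul]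
  exact Finset.measurable_sum _ fun n _ => (hpow n a b).const_mul _

/-- Linear statistics of the eigenvalues are measurable, by polynomial approximation of the
test function. -/
lemma measurable_sum_eigs (hmeas : ∀ a b, Measurable fun ω => H ω a b)
    (hsymm : ∀ ω, (H ω).IsHermitian) {f : ℝ → ℝ} (hf : Continuous f) :
    Measurable fun ω => ∑ a, f (eigs (H ω) a) := by
  choose p hp using fun n : ℕ => exists_polynomial_near_of_continuousOn (-(n : ℝ)) n f
    hf.continuousOn (1 / ((n : ℝ) + 1)) (by positivity)
  refine measurable_of_tendsto_metrizable
    (f := fun n ω => ∑ a, (p n).eval (eigs (H ω) a)) (fun n => ?_) ?_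
  · simp only [sum_polynomial_eval_eigs (hsymm _), Matrix.trace, Matrix.diag]
    exact Finset.measurable_sum _ fun a _ => measurable_aeval_entry hmeas _ a a
  · rw [tendsto_pi_nhds]
    intro ω
    refine tendsto_finsetSum _ fun a _ => ?_
    rw [tendsto_iff_norm_sub_tendsto_zero]
    refine squeeze_zero' (Eventually.of_forall fun n => norm_nonneg _) ?_
      tendsto_one_div_add_atTop_nhds_zero_nat
    filter_upwards [eventually_ge_atTop ⌈|eigs (H ω) a|⌉₊] with n hn
    exact (hp n _ (abs_le.mp (Nat.ceil_le.mp hn))).le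

lemma lintegral_empSpec (M : Matrix (Fin N) (Fin N) ℝ) {f : ℝ → ℝ≥0∞} (hf : Measurable f) :
    ∫⁻ x, f x ∂(empSpec M) = (N : ℝ≥0∞)⁻¹ * ∑ a, f (eigs M a) := by
  simp [empSpec, lintegral_smul_measure, lintegral_finsetSum_measure, lintegral_dirac' _ hf]

lemma isProbabilityMeasure_empSpec (hN : 1 ≤ N) (M : Matrix (Fin N) (Fin N) ℝ) :
    IsProbabilityMeasure (empSpec M) := by
  constructor
  have hN' : (N : ℝ≥0∞) ≠ 0 := by simp; omega
  simp [empSpec, ENNReal.inv_mul_cancel hN' (ENNReal.natCast_ne_top N)]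

lemma integral_empSpec (M : Matrix (Fin N) (Fin N) ℝ) (f : ℝ → ℝ) :
    ∫ x, f x ∂(empSpec M) = (N : ℝ)⁻¹ * ∑ a, f (eigs M a) := by
  rw [empSpec, integral_smul_measure, integral_finsetSum_measure]
  · simp
  · exact fun a _ => integrable_dirac (by simp)

lemma integrable_empSpec (hN : 1 ≤ N) (M : Matrix (Fin N) (Fin N) ℝ) (f : ℝ → ℝ) :
    Integrable f (empSpec M) := by
  refine Integrable.smul_measure ?_ (by simp; omega)
  exact integrable_finsetSum_measure.2 fun a _ => integrable_dirac (by simp)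

lemma measurable_empSpec (hN : 1 ≤ N) (hmeas : ∀ a b, Measurable fun ω => H ω a b)
    (hsymm : ∀ ω, (H ω).IsHermitian) : Measurable fun ω => empSpec (H ω) := by
  have := fun ω => isProbabilityMeasure_empSpec hN (H ω)
  refine Measurable.measure_of_isPiSystem_of_isProbabilityMeasure
    (S := {s : Set ℝ | IsClosed s})
    (by rw [BorelSpace.measurable_eq (α := ℝ), borel_eq_generateFrom_isClosed])
    isPiSystem_isClosed fun F hF => ?_
  refine measurable_of_tendsto_metrizable
    (f := fun n ω => ∫⁻ x, (hF.apprSeq n x : ℝ≥0∞) ∂(empSpec (H ω))) (fun n => ?_) ?_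
  · have hc : Continuous fun x => (hF.apprSeq n x : ℝ) :=
      NNReal.continuous_coe.comp (hF.apprSeq n).continuous
    have h : ∀ ω, ∫⁻ x, (hF.apprSeq n x : ℝ≥0∞) ∂(empSpec (H ω))
        = (N : ℝ≥0∞)⁻¹ * ENNReal.ofReal (∑ a, (hF.apprSeq n (eigs (H ω) a) : ℝ)) := by
      intro ω
      rw [lintegral_empSpec _ (by fun_prop), ENNReal.ofReal_sum_of_nonneg (by simp)]
      simp
    simp only [h]
    exact (measurable_sum_eigs hmeas hsymm hc).ennreal_ofReal.const_mul _
  · rw [tendsto_pi_nhds]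
    intro ω
    exact HasOuterApproxClosed.tendsto_lintegral_apprSeq hF _

variable {P : Measure Ω}

lemma isProbabilityMeasure_meanSpec [IsProbabilityMeasure P] (hN : 1 ≤ N)
    (hmeas : ∀ a b, Measurable fun ω => H ω a b)
    (hsymm : ∀ ω, (H ω).IsHermitian) : IsProbabilityMeasure (meanSpec P H) := by
  constructor
  have := fun ω => isProbabilityMeasure_empSpec hN (H ω)
  rw [meanSpec, Measure.bind_apply MeasurableSet.univ
    (measurable_empSpec hN hmeas hsymm).aemeasurable]
  simp

lemma integrable_meanSpec_and_integral_eq (hN : 1 ≤ N)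
    (hmeas : ∀ a b, Measurable fun ω => H ω a b)
    (hsymm : ∀ ω, (H ω).IsHermitian) {f : ℝ → ℝ} (hf : Continuous f)
    (hint : Integrable (fun ω => ∑ a, |f (eigs (H ω) a)|) P) :
    Integrable f (meanSpec P H) ∧
      ∫ x, f x ∂(meanSpec P H) = (N : ℝ)⁻¹ * ∫ ω, ∑ a, f (eigs (H ω) a) ∂P := by
  let k : Kernel Ω ℝ := ⟨fun ω => empSpec (H ω), measurable_empSpec hN hmeas hsymm⟩
  have hk : ∀ ω, k ω = empSpec (H ω) := fun _ => rfl
  have : IsMarkovKernel k := ⟨fun ω => isProbabilityMeasure_empSpec hN (H ω)⟩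
  have hkP : meanSpec P H = k ∘ₘ P := rfl
  have hI : Integrable f (k ∘ₘ P) := by
    rw [Measure.integrable_comp_iff hf.aestronglyMeasurable]
    refine ⟨ae_of_all _ fun ω => integrable_empSpec hN _ _, ?_⟩
    simp only [hk, integral_empSpec, Real.norm_eq_abs]
    exact hint.const_mul _
  refine ⟨hkP ▸ hI, ?_⟩
  rw [hkP]
  rw [Measure.comp_eq_comp_const_apply] at hI ⊢
  rw [Kernel.integral_comp hI]
  simp only [hk, integral_empSpec, Kernel.const_apply, integral_const_mul]

end Spectral

/-- The logarithm of `|x|`, truncated from below at scale `s`. -/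
noncomputable def truncLog (s x : ℝ) : ℝ := Real.log (max |x| s)

lemma truncLog_lipschitz {s : ℝ} (hs : 0 < s) (x y : ℝ) :
    |truncLog s x - truncLog s y| ≤ s⁻¹ * |x - y| := by
  have key : ∀ u v : ℝ, s ≤ u → s ≤ v → Real.log u - Real.log v ≤ s⁻¹ * |u - v| := by
    intro u v hu hv
    have hu' : 0 < u := hs.trans_le hu
    have hv' : 0 < v := hs.trans_le hv
    rw [← Real.log_div hu'.ne' hv'.ne']
    calc Real.log (u / v) ≤ u / v - 1 := Real.log_le_sub_one_of_pos (by positivity)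
      _ = v⁻¹ * (u - v) := by field_simp
      _ ≤ v⁻¹ * |u - v| := by gcongr; exact le_abs_self _
      _ ≤ s⁻¹ * |u - v| := by gcongr
  have hxy : |max |x| s - max |y| s| ≤ |x - y| :=
    (abs_max_sub_max_le_abs _ _ _).trans (abs_abs_sub_abs_le_abs_sub _ _)
  have h : ∀ u v : ℝ, s ≤ u → s ≤ v → |Real.log u - Real.log v| ≤ s⁻¹ * |u - v| :=
    fun u v hu hv => abs_le.2 ⟨by have := key v u hv hu; rw [abs_sub_comm] at this; linarith,
      key u v hu hv⟩
  exact (h _ _ (le_max_right _ _) (le_max_right _ _)).trans (by gcongr)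

lemma continuous_of_abs_sub_le {f : ℝ → ℝ} {L : ℝ}
    (hf : ∀ x y, |f x - f y| ≤ L * |x - y|) : Continuous f :=
  (LipschitzWith.of_dist_le' (K := L) fun x y => by simpa [Real.dist_eq] using hf x y).continuous

lemma log_abs_le_truncLog {s x : ℝ} (hx : x ≠ 0) : Real.log |x| ≤ truncLog s x :=
  Real.log_le_log (abs_pos.2 hx) (le_max_left _ _)

lemma truncLog_sub_log_le {s x r : ℝ} (hs : 0 < s) (hr : 0 < r) (hx : x ≠ 0) (hxs : |x| < s) :
    truncLog s x - Real.log |x| ≤ r⁻¹ * s ^ r * |x| ^ (-r) := by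
  have hx' := abs_pos.2 hx
  rw [truncLog, max_eq_right hxs.le, ← Real.log_div hs.ne' hx'.ne']
  refine (Real.log_le_rpow_div (by positivity) hr).trans_eq ?_
  rw [Real.div_rpow hs.le hx'.le, Real.rpow_neg hx'.le]
  field_simp

lemma truncLog_eq_log_abs {s x : ℝ} (hxs : s ≤ |x|) : truncLog s x = Real.log |x| := by
  rw [truncLog, max_eq_left hxs]

section Wasserstein

variable {ν μ : Measure ℝ} [IsProbabilityMeasure ν] [IsProbabilityMeasure μ]

lemma integrable_of_lipschitz (hν : Integrable (fun x => |x|) ν) {f : ℝ → ℝ} {L : ℝ}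
    (hf : ∀ x y, |f x - f y| ≤ L * |x - y|) : Integrable f ν := by
  refine ((hν.const_mul L).add (integrable_const |f 0|)).mono'
    (continuous_of_abs_sub_le hf).aestronglyMeasurable (ae_of_all _ fun x => ?_)
  have := hf x 0
  simp only [sub_zero, Pi.add_apply, Real.norm_eq_abs] at this ⊢
  linarith [abs_sub_abs_le_abs_sub (f x) (f 0)]

lemma abs_integral_sub_le_W1 (hν : Integrable (fun x => |x|) ν)
    (hμ : Integrable (fun x => |x|) μ) {f : ℝ → ℝ} {L : ℝ} (hL : 0 < L)
    (hf : ∀ x y, |f x - f y| ≤ L * |x - y|) :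
    |(∫ x, f x ∂ν) - ∫ x, f x ∂μ| ≤ L * W1 ν μ := by
  have hbdd : BddAbove {r : ℝ | ∃ f : ℝ → ℝ, (∀ x y, |f x - f y| ≤ |x - y|) ∧
      r = |(∫ x, f x ∂ν) - ∫ x, f x ∂μ|} := by
    refine ⟨(∫ x, |x| ∂ν) + ∫ x, |x| ∂μ, ?_⟩
    rintro r ⟨g, hg, rfl⟩
    have hg' : ∀ x y, |g x - g y| ≤ 1 * |x - y| := by simpa using hg
    have aux : ∀ (m : Measure ℝ) [IsProbabilityMeasure m], Integrable (fun x => |x|) m →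
        |(∫ x, g x ∂m) - g 0| ≤ ∫ x, |x| ∂m := by
      intro m _ hm
      have hgi := integrable_of_lipschitz hm hg'
      have : (∫ x, g x ∂m) - g 0 = ∫ x, (g x - g 0) ∂m := by
        rw [integral_sub hgi (integrable_const _)]; simp
      rw [this]
      refine (abs_integral_le_integral_abs).trans ?_
      exact integral_mono (hgi.sub (integrable_const _)).abs hm fun x => by simpa using hg x 0
    have h1 := abs_le.1 (aux ν hν)
    have h2 := abs_le.1 (aux μ hμ)
    exact abs_le.2 ⟨by linarith, by linarith⟩
  have h := le_csSup hbdd ⟨fun x => L⁻¹ * f x, fun x y => by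
    rw [← mul_sub, abs_mul, abs_of_pos (inv_pos.2 hL), inv_mul_le_iff₀ hL]; exact hf x y, rfl⟩
  rw [integral_const_mul, integral_const_mul, ← mul_sub, abs_mul, abs_of_pos (inv_pos.2 hL),
    inv_mul_le_iff₀ hL] at h
  exact h

end Wasserstein

section Density

lemma lintegral_rpow_abs_lt_top {κ r : ℝ} (hr : -1 < r) :
    ∫⁻ x in Set.Ioo (-κ) κ, ENNReal.ofReal (|x| ^ r) < ∞ := by
  have h0 : IntegrableOn (fun x : ℝ => |x| ^ r) (Set.Ioo 0 κ) := by
    have h := (intervalIntegral.intervalIntegrable_rpow' (a := 0) (b := max κ 0) hr).1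
    refine IntegrableOn.congr_fun (f := fun x => x ^ r)
      (h.mono_set fun x hx => ⟨hx.1, hx.2.le.trans (le_max_left _ _)⟩) ?_ measurableSet_Ioo
    exact fun x hx => by simp only [abs_of_pos hx.1]
  have h1 : IntegrableOn (fun x : ℝ => |x| ^ r) (Set.Ioo (-κ) 0) := by
    have h := h0.comp_neg
    simpa using h
  have h2 : IntegrableOn (fun x : ℝ => |x| ^ r) (Set.Ioo (-κ) κ) := by
    have h := (h1.union (integrableOn_singleton (x := (0 : ℝ)) (hx := by simp))).union h0
    refine h.mono_set fun x hx => ?_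
    rcases lt_trichotomy x 0 with h | h | h
    · exact Or.inl (Or.inl ⟨hx.1, h⟩)
    · exact Or.inl (Or.inr h)
    · exact Or.inr ⟨h, hx.2⟩
  exact h2.lintegral_lt_top

variable {μ : Measure ℝ} {κ : ℝ} {ρ : ℝ → ℝ}

lemma lintegral_rpow_neg_le_of_density (hκ : 0 < κ)
    (hρ : ∀ s ⊆ Set.Ioo (-κ) κ, MeasurableSet s → μ s = ∫⁻ x in s, ENNReal.ofReal (ρ x))
    (hρb : ∀ x : ℝ, |x| < κ → ρ x < κ⁻¹ * |x| ^ (-1 + κ)) :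
    ∫⁻ x in Set.Ioo (-κ) κ, ENNReal.ofReal (|x| ^ (-(κ / 2))) ∂μ
      ≤ ENNReal.ofReal κ⁻¹ * ∫⁻ x in Set.Ioo (-κ) κ, ENNReal.ofReal (|x| ^ (-1 + κ / 2)) := by
  set I := Set.Ioo (-κ) κ
  set w : ℝ → ℝ≥0∞ := fun x => ENNReal.ofReal (κ⁻¹ * |x| ^ (-1 + κ)) with hw
  have hwm : Measurable w := by fun_prop
  have hle : μ.restrict I ≤ (volume.restrict I).withDensity w := by
    refine Measure.le_iff.2 fun s hs => ?_
    rw [Measure.restrict_apply hs, withDensity_apply _ hs, Measure.restrict_restrict hs,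
      hρ _ Set.inter_subset_right (hs.inter measurableSet_Ioo)]
    exact setLIntegral_mono' (hs.inter measurableSet_Ioo) fun x hx =>
      ENNReal.ofReal_le_ofReal (hρb x (abs_lt.2 hx.2)).le
  refine (lintegral_mono' hle le_rfl).trans ?_
  rw [lintegral_withDensity_eq_lintegral_mul _ hwm (by fun_prop),
    ← lintegral_const_mul _ (by fun_prop)]
  refine lintegral_mono fun x => ?_
  simp only [Pi.mul_apply, hw]
  rw [← ENNReal.ofReal_mul (by positivity), ← ENNReal.ofReal_mul (by positivity)]
  refine ENNReal.ofReal_le_ofReal ?_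
  rw [mul_assoc]
  gcongr
  rcases eq_or_ne x 0 with rfl | hx
  · rw [abs_zero, Real.zero_rpow (x := -(κ / 2)) (by linarith), mul_zero]
    positivity
  · rw [← Real.rpow_add (abs_pos.2 hx)]
    exact (congrArg _ (by ring)).le

lemma measure_zero_singleton_of_density (hκ : 0 < κ)
    (hρ : ∀ s ⊆ Set.Ioo (-κ) κ, MeasurableSet s → μ s = ∫⁻ x in s, ENNReal.ofReal (ρ x)) :
    μ {0} = 0 := by
  rw [hρ {0} (by simpa using hκ) (measurableSet_singleton 0)]
  simp

/-- Truncating the logarithm at scale `s` changes its integral by `O(s ^ (κ / 2))`, uniformly over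
the measures with the given density bound near the origin. -/
lemma exists_integral_truncLog_sub_le (hκ : 0 < κ) : ∃ C : ℝ, 0 ≤ C ∧
    ∀ (μ : Measure ℝ) [IsProbabilityMeasure μ], Integrable (fun x => |x|) μ → ∀ ρ : ℝ → ℝ,
    (∀ s ⊆ Set.Ioo (-κ) κ, MeasurableSet s → μ s = ∫⁻ x in s, ENNReal.ofReal (ρ x)) →
    (∀ x : ℝ, |x| < κ → ρ x < κ⁻¹ * |x| ^ (-1 + κ)) →
    ∀ s : ℝ, 0 < s → s ≤ κ →
      |(∫ x, truncLog s x ∂μ) - ∫ x, Real.log |x| ∂μ| ≤ C * s ^ (κ / 2) := by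
  set K : ℝ≥0∞ := ENNReal.ofReal κ⁻¹ *
    ∫⁻ x in Set.Ioo (-κ) κ, ENNReal.ofReal (|x| ^ (-1 + κ / 2)) with hK
  have hKtop : K ≠ ∞ :=
    ENNReal.mul_ne_top ENNReal.ofReal_ne_top (lintegral_rpow_abs_lt_top (by linarith)).ne
  refine ⟨(κ / 2)⁻¹ * K.toReal, by positivity, ?_⟩
  intro μ _ hμ ρ hρ hρb s hs hsκ
  have hne : ∀ᵐ x ∂μ, x ≠ 0 := by
    rw [ae_iff]
    simpa using measure_zero_singleton_of_density hκ hρ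
  set g : ℝ → ℝ := fun x => truncLog s x - Real.log |x| with hg
  have hgm : Measurable g := by unfold g truncLog; fun_prop
  have hg0 : 0 ≤ᵐ[μ] g := by
    filter_upwards [hne] with x hx
    exact sub_nonneg.2 (log_abs_le_truncLog hx)
  set B : ℝ := (κ / 2)⁻¹ * s ^ (κ / 2) with hB
  have hB0 : 0 ≤ B := by positivity
  have hlint : ∫⁻ x, ENNReal.ofReal (g x) ∂μ ≤ ENNReal.ofReal B * K := by
    calc ∫⁻ x, ENNReal.ofReal (g x) ∂μ
        ≤ ∫⁻ x, (Set.Ioo (-κ) κ).indicator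
            (fun x => ENNReal.ofReal B * ENNReal.ofReal (|x| ^ (-(κ / 2)))) x ∂μ := by
          refine lintegral_mono_ae ?_
          filter_upwards [hne] with x hx
          rcases lt_or_ge |x| s with hxs | hxs
          · rw [Set.indicator_of_mem (show x ∈ Set.Ioo (-κ) κ from abs_lt.1 (hxs.trans_le hsκ)),
              ← ENNReal.ofReal_mul hB0]
            exact ENNReal.ofReal_le_ofReal (truncLog_sub_log_le hs (by positivity) hx hxs)
          · simp [hg, truncLog_eq_log_abs hxs]
      _ = ENNReal.ofReal B *
            ∫⁻ x in Set.Ioo (-κ) κ, ENNReal.ofReal (|x| ^ (-(κ / 2))) ∂μ := by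
          rw [lintegral_indicator measurableSet_Ioo, lintegral_const_mul _ (by fun_prop)]
      _ ≤ ENNReal.ofReal B * K := by
          gcongr
          exact lintegral_rpow_neg_le_of_density hκ hρ hρb
  have hfin : ENNReal.ofReal B * K ≠ ∞ := ENNReal.mul_ne_top ENNReal.ofReal_ne_top hKtop
  have hgi : Integrable g μ := by
    refine ⟨hgm.aestronglyMeasurable, ?_⟩
    rw [hasFiniteIntegral_iff_ofReal hg0]
    exact hlint.trans_lt hfin.lt_top
  have hti : Integrable (truncLog s) μ := integrable_of_lipschitz hμ (truncLog_lipschitz hs)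
  have hli : Integrable (fun x => Real.log |x|) μ := by
    refine (hti.sub hgi).congr (ae_of_all _ fun x => ?_)
    simp only [hg, Pi.sub_apply, sub_sub_cancel]
  rw [← integral_sub hti hli, abs_of_nonneg (integral_nonneg_of_ae hg0),
    integral_eq_lintegral_of_nonneg_ae hg0 hgm.aestronglyMeasurable]
  calc (∫⁻ x, ENNReal.ofReal (g x) ∂μ).toReal ≤ (ENNReal.ofReal B * K).toReal :=
        ENNReal.toReal_mono hfin hlint
    _ = (κ / 2)⁻¹ * K.toReal * s ^ (κ / 2) := by
        rw [ENNReal.toReal_mul, ENNReal.toReal_ofReal hB0, hB]; ring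

end Density

lemma integrable_abs_of_compact_support {μ : Measure ℝ} [IsProbabilityMeasure μ] {R : ℝ}
    (h : μ (Set.Icc (-R) R)ᶜ = 0) : Integrable (fun x => |x|) μ := by
  refine (integrable_const R).mono' (by fun_prop) ?_
  filter_upwards [measure_eq_zero_iff_ae_notMem.1 h] with x hx
  simpa [abs_le] using not_not.1 hx

section ExponentialMoment

variable {Ω : Type*} [MeasurableSpace Ω] {P : Measure Ω} [IsProbabilityMeasure P]

lemma ofReal_exp_le_tsum_indicator {q δ y : ℝ} (hq : 0 < q) (hδ : 0 < δ) :
    ENNReal.ofReal (Real.exp (q * y)) ≤ ENNReal.ofReal (Real.exp (q * δ)) +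
      ∑' k : ℕ, ENNReal.ofReal (Real.exp (q * ((k + 2) * δ))) *
        (Set.Ioi ((k + 1) * δ)).indicator 1 y := by
  rcases le_or_gt y δ with h | h
  · refine le_add_right (ENNReal.ofReal_le_ofReal ?_)
    gcongr
  · obtain ⟨k, hk⟩ : ∃ k : ℕ, ⌈y / δ⌉₊ = k + 2 := by
      have : 1 < ⌈y / δ⌉₊ := Nat.lt_ceil.2 (by rw [Nat.cast_one, one_lt_div hδ]; exact h)
      exact ⟨⌈y / δ⌉₊ - 2, by omega⟩
    have h1 : y ≤ (k + 2) * δ := by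
      have := Nat.le_ceil (y / δ)
      rw [hk, div_le_iff₀ hδ] at this
      exact_mod_cast this
    have h2 : (k + 1) * δ < y := by
      have : k + 1 < ⌈y / δ⌉₊ := by omega
      rw [Nat.lt_ceil, lt_div_iff₀ hδ] at this
      exact_mod_cast this
    refine le_add_left (le_trans ?_ (ENNReal.le_tsum k))
    rw [Set.indicator_of_mem (show y ∈ Set.Ioi _ from h2), Pi.one_apply, mul_one]
    refine ENNReal.ofReal_le_ofReal ?_
    gcongr

/-- Exponential tails give an exponential moment. -/
lemma lintegral_exp_le_of_tail {g : Ω → ℝ} (hg : Measurable g) {q δ : ℝ} (hq : 0 < q)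
    (hδ : 0 < δ)
    (htail : ∀ t, δ ≤ t → P {ω | t < |g ω|} ≤ ENNReal.ofReal (Real.exp (-(2 * q * t)))) :
    ∫⁻ ω, ENNReal.ofReal (Real.exp (q * |g ω|)) ∂P ≤
      ENNReal.ofReal (Real.exp (q * δ)) + (1 - ENNReal.ofReal (Real.exp (-(q * δ))))⁻¹ := by
  have hind : ∀ k : ℕ, Measurable fun ω =>
      (Set.Ioi (((k : ℝ) + 1) * δ)).indicator (1 : ℝ → ℝ≥0∞) |g ω| := fun k =>
    (measurable_one.indicator measurableSet_Ioi).comp (measurable_abs.comp hg)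
  calc ∫⁻ ω, ENNReal.ofReal (Real.exp (q * |g ω|)) ∂P
      ≤ ∫⁻ ω, (ENNReal.ofReal (Real.exp (q * δ)) +
          ∑' k : ℕ, ENNReal.ofReal (Real.exp (q * ((k + 2) * δ))) *
          (Set.Ioi (((k : ℝ) + 1) * δ)).indicator 1 |g ω|) ∂P :=
        lintegral_mono fun ω => ofReal_exp_le_tsum_indicator hq hδ
    _ = ENNReal.ofReal (Real.exp (q * δ)) + ∑' k : ℕ,
          ENNReal.ofReal (Real.exp (q * ((k + 2) * δ))) * P {ω | (k + 1) * δ < |g ω|} := by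
        rw [lintegral_add_left measurable_const, lintegral_const, measure_univ, mul_one,
          lintegral_tsum fun k => ((hind k).const_mul _).aemeasurable]
        congr 2
        ext k
        rw [lintegral_const_mul _ (hind k)]
        congr 1
        have hm : MeasurableSet {ω | ((k : ℝ) + 1) * δ < |g ω|} :=
          measurableSet_lt measurable_const (measurable_abs.comp hg)
        rw [← lintegral_indicator_one hm]
        rfl
    _ ≤ _ := by
        rw [← ENNReal.tsum_geometric]
        gcongr with k
        refine (mul_le_mul_right (htail _ ?_) _).trans_eq ?_
        · nlinarith [Nat.cast_nonneg (α := ℝ) k]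
        · rw [← ENNReal.ofReal_mul (by positivity), ← ENNReal.ofReal_pow (by positivity),
            ← Real.exp_add, ← Real.exp_nat_mul]
          congr 2
          ring

lemma integrable_of_exp_tail {g : Ω → ℝ} (hg : Measurable g) {q δ : ℝ} (hq : 0 < q)
    (hδ : 0 < δ)
    (htail : ∀ t, δ ≤ t → P {ω | t < |g ω|} ≤ ENNReal.ofReal (Real.exp (-(2 * q * t)))) :
    Integrable g P := by
  have h1 : Integrable (fun ω => Real.exp (q * |g ω|)) P := by
    refine ⟨by fun_prop, ?_⟩
    rw [hasFiniteIntegral_iff_ofReal (ae_of_all _ fun ω => (Real.exp_pos _).le)]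
    refine (lintegral_exp_le_of_tail hg hq hδ htail).trans_lt ?_
    refine ENNReal.add_lt_top.2 ⟨ENNReal.ofReal_lt_top, ?_⟩
    rw [lt_top_iff_ne_top, Ne, ENNReal.inv_eq_top, tsub_eq_zero_iff_le, not_le]
    rw [ENNReal.ofReal_lt_one, Real.exp_lt_one_iff]
    have := mul_pos hq hδ
    linarith
  refine (h1.const_mul q⁻¹).mono' hg.aestronglyMeasurable (ae_of_all _ fun ω => ?_)
  rw [Real.norm_eq_abs, le_inv_mul_iff₀ hq]
  linarith [Real.add_one_le_exp (q * |g ω|)]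

end ExponentialMoment

lemma rpow_le_min_of_one_le {x r : ℝ} (hx : 1 ≤ x) :
    x ^ (1 + min r 1) ≤ min (x ^ (2 : ℝ)) (x ^ (1 + r)) :=
  le_min (Real.rpow_le_rpow_of_exponent_le hx (by linarith [min_le_right r 1]))
    (Real.rpow_le_rpow_of_exponent_le hx (by linarith [min_le_left r 1]))

lemma superlinear_lower_bound {c N L δ t q r : ℝ} (hc : 0 ≤ c) (hN : 0 < N) (hL : 0 < L)
    (hr : 0 < r) (hδ : 1 ≤ N * δ / L)
    (hq : 2 * q ≤ c * (N / L) * (N * δ / L) ^ min r 1) (ht : δ ≤ t) :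
    2 * q * t ≤ c * min ((N * t / L) ^ (2 : ℝ)) ((N * t / L) ^ (1 + r)) := by
  have hx : N * δ / L ≤ N * t / L := by gcongr
  have hx1 : 1 ≤ N * t / L := hδ.trans hx
  have hx0 : 0 < N * t / L := by linarith
  have ht0 : 0 < t := by
    have h : N * t / L = t * (N / L) := by ring
    rw [h] at hx0
    exact pos_of_mul_pos_left hx0 (by positivity)
  have hr1 : 0 < min r 1 := lt_min hr one_pos
  calc 2 * q * t ≤ c * (N / L) * (N * δ / L) ^ min r 1 * t := by gcongr
    _ ≤ c * (N / L) * (N * t / L) ^ min r 1 * t := by gcongr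
    _ = c * (N * t / L) ^ (1 + min r 1) := by
        rw [Real.rpow_add hx0, Real.rpow_one]; ring
    _ ≤ _ := by gcongr; exact rpow_le_min_of_one_le hx1

section Tail

variable {Ω : Type*} [MeasurableSpace Ω] {P : Measure Ω}
  {N : ℕ} {H : Ω → Matrix (Fin N) (Fin N) ℝ}

/-- The fluctuation of the normalized linear statistic `N⁻¹ * Tr f (H)` about its mean. -/
noncomputable def fluct (P : Measure Ω) (H : Ω → Matrix (Fin N) (Fin N) ℝ) (f : ℝ → ℝ)
    (ω : Ω) : ℝ :=
  (N : ℝ)⁻¹ * (∑ a, f (eigs (H ω) a)) - (N : ℝ)⁻¹ * ∫ ω', (∑ a, f (eigs (H ω') a)) ∂P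

lemma measurable_fluct (hmeas : ∀ a b, Measurable fun ω => H ω a b)
    (hsymm : ∀ ω, (H ω).IsHermitian) {f : ℝ → ℝ} (hf : Continuous f) :
    Measurable (fluct P H f) :=
  ((measurable_sum_eigs hmeas hsymm hf).const_mul _).sub_const _

lemma measure_fluct_le [IsProbabilityMeasure P] {f : ℝ → ℝ} {c L δ q r t : ℝ}
    (hN : 1 ≤ N) (hc : 0 < c) (hL : 0 < L)
    (hr : 0 < r)
    (hconc : ∀ δ : ℝ, 0 < δ → (P {ω | δ < |fluct P H f ω|}).toReal ≤
      Real.exp (-c * min (((N : ℝ) * δ / L) ^ (2 : ℝ)) (((N : ℝ) * δ / L) ^ (1 + r))))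
    (hδ : 1 ≤ N * δ / L) (hq : 2 * q ≤ c * (N / L) * (N * δ / L) ^ min r 1) (ht : δ ≤ t) :
    P {ω | t < |fluct P H f ω|} ≤ ENNReal.ofReal (Real.exp (-(2 * q * t))) := by
  have hN' : (0 : ℝ) < N := by exact_mod_cast hN
  have ht0 : 0 < t := by
    have h : N * δ / L = δ * (N / L) := by ring
    rw [h] at hδ
    exact (pos_of_mul_pos_left (one_pos.trans_le hδ) (by positivity)).trans_le ht
  rw [← ENNReal.ofReal_toReal (measure_ne_top P {ω | t < |fluct P H f ω|})]
  refine ENNReal.ofReal_le_ofReal ((hconc t ht0).trans (Real.exp_le_exp.2 ?_))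
  rw [neg_mul]
  exact neg_le_neg (superlinear_lower_bound hc.le hN' hL hr hδ hq ht)

lemma integrable_sum_eigs_of_concentration [IsProbabilityMeasure P]
    (hmeas : ∀ a b, Measurable fun ω => H ω a b)
    (hsymm : ∀ ω, (H ω).IsHermitian) {f : ℝ → ℝ} (hf : Continuous f)
    {c L r : ℝ} (hN : 1 ≤ N) (hc : 0 < c) (hL : 0 < L) (hr : 0 < r)
    (hconc : ∀ δ : ℝ, 0 < δ → (P {ω | δ < |fluct P H f ω|}).toReal ≤
      Real.exp (-c * min (((N : ℝ) * δ / L) ^ (2 : ℝ)) (((N : ℝ) * δ / L) ^ (1 + r)))) :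
    Integrable (fun ω => ∑ a, f (eigs (H ω) a)) P := by
  have hN' : (0 : ℝ) < N := by exact_mod_cast hN
  have hδ : (N : ℝ) * (L / N) / L = 1 := by field_simp
  have h := integrable_of_exp_tail (P := P) (measurable_fluct hmeas hsymm hf)
    (q := c * (N / L) / 2) (δ := L / N) (by positivity) (by positivity)
    fun t ht => measure_fluct_le hN hc hL hr hconc hδ.ge
      (by rw [hδ, Real.one_rpow]; linarith) ht
  have h2 := (h.add (integrable_const
    ((N : ℝ)⁻¹ * ∫ ω', (∑ a, f (eigs (H ω') a)) ∂P))).const_mul (N : ℝ)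
  refine h2.congr (ae_of_all _ fun ω => ?_)
  simp only [fluct, Pi.add_apply]
  field_simp
  ring

end Tail

/-- A sequence of random symmetric matrices whose mean spectral measure is Wasserstein-close to
`μ N`, whose Lipschitz linear statistics concentrate, and which has a spectral gap at `0` of
subexponential size with high probability. -/
structure ConcentratedInput (κ : ℝ) {Ω : ℕ → Type*} [mΩ : ∀ N, MeasurableSpace (Ω N)]
    (P : ∀ N, Measure (Ω N)) (H : ∀ N : ℕ, Ω N → Matrix (Fin N) (Fin N) ℝ)
    (μ : ℕ → Measure ℝ) : Prop where
  measurable_entry : ∀ N a b, Measurable fun ω => H N ω a b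
  isHermitian : ∀ N ω, (H N ω).IsHermitian
  W1_le : ∀ N : ℕ, 1 ≤ N → W1 (meanSpec (P N) (H N)) (μ N) ≤ (N : ℝ) ^ (-κ)
  support : ∃ R : ℝ, 0 < R ∧ ∀ N, (μ N) (Set.Icc (-R) R)ᶜ = 0
  density : ∃ ρ : ℕ → ℝ → ℝ,
    (∀ N, ∀ s ⊆ Set.Ioo (-κ) κ, MeasurableSet s →
      μ N s = ∫⁻ x in s, ENNReal.ofReal (ρ N x)) ∧
    (∀ N, ∀ x : ℝ, |x| < κ → ρ N x < κ⁻¹ * |x| ^ (-1 + κ))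
  concentration : ∃ ε₀ : ℝ, 0 < ε₀ ∧ ∀ ζ : ℝ, 0 < ζ → ∃ c : ℝ, 0 < c ∧
    ∀ N : ℕ, 1 ≤ N → ∀ f : ℝ → ℝ, ∀ L : ℝ, 0 < L →
      (∀ x y, |f x - f y| ≤ L * |x - y|) → ∀ δ : ℝ, 0 < δ →
      (P N {ω | δ < |fluct (P N) (H N) f ω|}).toReal
        ≤ Real.exp (-(c / (N : ℝ) ^ ζ) *
            min (((N : ℝ) * δ / L) ^ (2 : ℝ)) (((N : ℝ) * δ / L) ^ (1 + ε₀)))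
  gap : ∀ ε : ℝ, 0 < ε → Tendsto (fun N : ℕ => (P N {ω | ∀ a, eigs (H N ω) a ∉
      Set.Icc (-(Real.exp (-(N : ℝ) ^ ε))) (Real.exp (-(N : ℝ) ^ ε))}).toReal) atTop (nhds 1)

lemma tendsto_natCast_rpow_neg {b : ℝ} (hb : 0 < b) :
    Tendsto (fun N : ℕ => (N : ℝ) ^ (-b)) atTop (nhds 0) :=
  (tendsto_rpow_neg_atTop hb).comp tendsto_natCast_atTop_atTop

lemma tendsto_natCast_rpow {b : ℝ} (hb : 0 < b) :
    Tendsto (fun N : ℕ => (N : ℝ) ^ b) atTop atTop :=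
  (tendsto_rpow_atTop hb).comp tendsto_natCast_atTop_atTop

lemma tendsto_exp_neg_natCast_mul {b : ℝ} (hb : 0 < b) :
    Tendsto (fun N : ℕ => Real.exp (-(b * N))) atTop (nhds 0) :=
  Real.tendsto_exp_neg_atTop_nhds_zero.comp
    (tendsto_natCast_atTop_atTop.const_mul_atTop hb)

lemma eventually_superlinear_threshold {c δ p r τ : ℝ} (hc : 0 < c) (hδ : 0 < δ) (hr : 0 < r)
    (hτ : τ ≤ min r 1 / 4) :
    ∀ᶠ N : ℕ in atTop, 1 ≤ N * δ / (N : ℝ) ^ τ ∧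
      2 * (p * N) ≤ c / (N : ℝ) ^ (min r 1 / 4) * (N / (N : ℝ) ^ τ) *
        (N * δ / (N : ℝ) ^ τ) ^ min r 1 := by
  set e := min r 1 with he
  have he0 : 0 < e := lt_min hr one_pos
  have he1 : e ≤ 1 := min_le_right _ _
  have h1 : Tendsto (fun N : ℕ => δ * (N : ℝ) ^ (1 - τ)) atTop atTop :=
    (tendsto_natCast_rpow (by linarith)).const_mul_atTop hδ
  have h2 : Tendsto (fun N : ℕ => c * δ ^ e * (N : ℝ) ^ ((1 - τ) * e - τ - e / 4)) atTop atTop :=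
    (tendsto_natCast_rpow (by nlinarith)).const_mul_atTop (by positivity)
  filter_upwards [h1.eventually_ge_atTop 1, h2.eventually_ge_atTop (2 * p),
    eventually_ge_atTop 1] with N hN1 hN2 hN
  have hN0 : (0 : ℝ) < N := by exact_mod_cast hN
  have hx : N * δ / (N : ℝ) ^ τ = δ * (N : ℝ) ^ (1 - τ) := by
    rw [Real.rpow_sub hN0, Real.rpow_one]; ring
  refine ⟨hx ▸ hN1, ?_⟩
  rw [hx, Real.mul_rpow hδ.le (by positivity), ← Real.rpow_mul hN0.le]
  have hy : c / (N : ℝ) ^ (e / 4) * (N / (N : ℝ) ^ τ) * (δ ^ e * (N : ℝ) ^ ((1 - τ) * e)) =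
      c * δ ^ e * (N : ℝ) ^ ((1 - τ) * e - τ - e / 4) * N := by
    rw [Real.rpow_sub hN0, Real.rpow_sub hN0]; ring
  rw [hy]
  calc 2 * (p * N) = 2 * p * N := by ring
    _ ≤ _ := by gcongr

namespace ConcentratedInput

variable {κ : ℝ} {Ω : ℕ → Type*} [mΩ : ∀ N, MeasurableSpace (Ω N)]
  {P : ∀ N, Measure (Ω N)}
  {H : ∀ N : ℕ, Ω N → Matrix (Fin N) (Fin N) ℝ}
  {μ : ℕ → Measure ℝ}

lemma integrable_sum_eigs [∀ N, IsProbabilityMeasure (P N)]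
    (h : ConcentratedInput κ P H μ) {N : ℕ} (hN : 1 ≤ N) {f : ℝ → ℝ}
    {L : ℝ} (hL : 0 < L) (hf : ∀ x y, |f x - f y| ≤ L * |x - y|) :
    Integrable (fun ω => ∑ a, f (eigs (H N ω) a)) (P N) := by
  obtain ⟨ε₀, hε₀, hc⟩ := h.concentration
  obtain ⟨c, hc, hconc⟩ := hc 1 one_pos
  have hN' : (0 : ℝ) < N := by exact_mod_cast hN
  exact integrable_sum_eigs_of_concentration (h.measurable_entry N) (h.isHermitian N)
    (continuous_of_abs_sub_le hf) hN (c := c / (N : ℝ) ^ (1 : ℝ)) (by positivity) hL hε₀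
    (hconc N hN f L hL hf)

lemma integrable_abs [∀ N, IsProbabilityMeasure (μ N)] (h : ConcentratedInput κ P H μ) (N : ℕ) :
    Integrable (fun x => |x|) (μ N) := by
  obtain ⟨R, -, hR⟩ := h.support
  exact integrable_abs_of_compact_support (hR N)

lemma mean_sub_integral_le [∀ N, IsProbabilityMeasure (P N)]
    [∀ N, IsProbabilityMeasure (μ N)] (h : ConcentratedInput κ P H μ) {N : ℕ} (hN : 1 ≤ N)
    {f : ℝ → ℝ} {L : ℝ} (hL : 0 < L) (hf : ∀ x y, |f x - f y| ≤ L * |x - y|) :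
    |(N : ℝ)⁻¹ * (∫ ω, ∑ a, f (eigs (H N ω) a) ∂(P N)) - ∫ x, f x ∂(μ N)|
      ≤ L * (N : ℝ) ^ (-κ) := by
  have := isProbabilityMeasure_meanSpec (P := P N) hN (h.measurable_entry N) (h.isHermitian N)
  have habs : ∀ x y : ℝ, |(|x|) - (|y|)| ≤ 1 * |x - y| := fun x y => by
    rw [one_mul]
    exact abs_abs_sub_abs_le_abs_sub x y
  have hi1 : Integrable (fun ω => ∑ a, |(|eigs (H N ω) a|)|) (P N) := by
    simp only [abs_abs]
    exact h.integrable_sum_eigs hN (f := fun x => |x|) one_pos habs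
  have h1 : Integrable (fun x : ℝ => |x|) (meanSpec (P N) (H N)) :=
    (integrable_meanSpec_and_integral_eq (f := fun x => |x|) hN (h.measurable_entry N)
      (h.isHermitian N) (continuous_abs : Continuous fun x : ℝ => |x|) hi1).1
  have hfabs : ∀ x y : ℝ, |(|f x|) - (|f y|)| ≤ L * |x - y| := fun x y =>
    (abs_abs_sub_abs_le_abs_sub _ _).trans (hf x y)
  have hi2 : Integrable (fun ω => ∑ a, |f (eigs (H N ω) a)|) (P N) :=
    h.integrable_sum_eigs hN (f := fun x => |f x|) hL hfabs
  have h2 := (integrable_meanSpec_and_integral_eq (f := f) hN (h.measurable_entry N)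
    (h.isHermitian N) (continuous_of_abs_sub_le hf) hi2).2
  rw [← h2]
  exact (abs_integral_sub_le_W1 h1 (h.integrable_abs N) hL hf).trans
    (mul_le_mul_of_nonneg_left (h.W1_le N hN) hL.le)

/-- The normalized mean of the linear statistic `Tr truncLog s`. -/
noncomputable def meanTruncLog (P : ∀ N, Measure (Ω N))
    (H : ∀ N : ℕ, Ω N → Matrix (Fin N) (Fin N) ℝ) (N : ℕ) (s : ℝ) : ℝ :=
  (N : ℝ)⁻¹ * ∫ ω, ∑ a, truncLog s (eigs (H N ω) a) ∂(P N)

lemma exists_meanTruncLog_sub_le [∀ N, IsProbabilityMeasure (P N)]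
    [∀ N, IsProbabilityMeasure (μ N)] (h : ConcentratedInput κ P H μ) (hκ : 0 < κ) :
    ∃ C : ℝ, 0 ≤ C ∧ ∀ N : ℕ, 1 ≤ N → ∀ s : ℝ, 0 < s → s ≤ κ →
      |meanTruncLog P H N s - ∫ x, Real.log |x| ∂(μ N)|
        ≤ s⁻¹ * (N : ℝ) ^ (-κ) + C * s ^ (κ / 2) := by
  obtain ⟨C, hC, hlog⟩ := exists_integral_truncLog_sub_le hκ
  obtain ⟨ρ, hρ, hρb⟩ := h.density
  refine ⟨C, hC, fun N hN s hs hsκ => ?_⟩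
  have h1 := h.mean_sub_integral_le hN (inv_pos.2 hs) (truncLog_lipschitz hs)
  have h2 := hlog (μ N) (h.integrable_abs N) (ρ N) (hρ N) (hρb N) s hs hsκ
  exact (abs_sub_le _ (∫ x, truncLog s x ∂(μ N)) _).trans (add_le_add h1 h2)

/-- At the truncation scale `A * N ^ (-τ)` with `τ` small, the normalized mean of
`Tr truncLog` approximates `∫ log |x| dμ` up to a negative power of `N`. -/
lemma tendsto_rpow_mul_meanTruncLog_sub [∀ N, IsProbabilityMeasure (P N)]
    [∀ N, IsProbabilityMeasure (μ N)] (h : ConcentratedInput κ P H μ) (hκ : 0 < κ)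
    {τ ε A : ℝ} (hτ : 0 < τ) (hε : ε < κ - τ) (hε' : ε < τ * (κ / 2)) (hA : 0 < A) :
    Tendsto (fun N : ℕ => (N : ℝ) ^ ε *
      |meanTruncLog P H N (A * (N : ℝ) ^ (-τ)) - ∫ x, Real.log |x| ∂(μ N)|) atTop (nhds 0) := by
  obtain ⟨C, hC, hmean⟩ := h.exists_meanTruncLog_sub_le hκ
  have hlim : Tendsto (fun N : ℕ => A⁻¹ * (N : ℝ) ^ (-(κ - τ - ε)) +
      C * A ^ (κ / 2) * (N : ℝ) ^ (-(τ * (κ / 2) - ε))) atTop (nhds 0) := by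
    simpa using ((tendsto_natCast_rpow_neg (sub_pos.2 hε)).const_mul A⁻¹).add
      ((tendsto_natCast_rpow_neg (sub_pos.2 hε')).const_mul (C * A ^ (κ / 2)))
  have hs : Tendsto (fun N : ℕ => A * (N : ℝ) ^ (-τ)) atTop (nhds 0) := by
    simpa using (tendsto_natCast_rpow_neg hτ).const_mul A
  refine squeeze_zero' (Eventually.of_forall fun N => by positivity) ?_ hlim
  filter_upwards [hs.eventually_le_const hκ, eventually_ge_atTop 1] with N hsN hN
  have hN0 : (0 : ℝ) < N := by exact_mod_cast hN
  refine (mul_le_mul_of_nonneg_left (hmean N hN _ (by positivity) hsN) (by positivity)).trans_eq ?_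
  rw [Real.mul_rpow hA.le (by positivity), ← Real.rpow_mul hN0.le, mul_inv, ← Real.rpow_neg hN0.le]
  rw [show -(κ - τ - ε) = ε + - -τ + -κ by ring,
    show -(τ * (κ / 2) - ε) = ε + -τ * (κ / 2) by ring]
  simp only [Real.rpow_add hN0]
  ring

end ConcentratedInput

lemma truncLog_sub_le_log_abs {s x y : ℝ} (hs : 0 < s) (hs1 : s ≤ 1) (hy : 0 ≤ y)
    (hx : x ∉ Set.Icc (-Real.exp (-y)) (Real.exp (-y))) :
    truncLog s x - y * (truncLog (Real.exp 1 * s) x - truncLog s x) ≤ Real.log |x| := by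
  have hes : s ≤ Real.exp 1 * s := le_mul_of_one_le_left hs.le (Real.one_le_exp zero_le_one)
  rcases le_or_gt s |x| with hxs | hxs
  · have : 0 ≤ truncLog (Real.exp 1 * s) x - truncLog s x :=
      sub_nonneg.2 (Real.log_le_log (lt_max_of_lt_right hs) (max_le_max le_rfl hes))
    rw [← truncLog_eq_log_abs hxs]
    nlinarith
  · have h1 : truncLog s x = Real.log s := by rw [truncLog, max_eq_right hxs.le]
    have h2 : truncLog (Real.exp 1 * s) x = 1 + Real.log s := by
      rw [truncLog, max_eq_right (hxs.le.trans hes), Real.log_mul (Real.exp_pos _).ne' hs.ne',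
        Real.log_exp]
    have h3 : -y ≤ Real.log |x| := by
      rw [Set.mem_Icc, ← abs_le, not_le] at hx
      rw [← Real.log_exp (-y)]
      exact Real.log_le_log (Real.exp_pos _) hx.le
    have h4 : Real.log s ≤ 0 := Real.log_nonpos hs.le hs1
    rw [h1, h2]
    linarith

namespace ConcentratedInput

variable {κ : ℝ} {Ω : ℕ → Type*} {H : ∀ N : ℕ, Ω N → Matrix (Fin N) (Fin N) ℝ}
  {μ : ℕ → Measure ℝ}

/-- The absolute value of the determinant, divided by its asymptotic size. -/
noncomputable def normDet (H : ∀ N : ℕ, Ω N → Matrix (Fin N) (Fin N) ℝ) (μ : ℕ → Measure ℝ)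
    (N : ℕ) (ω : Ω N) : ℝ :=
  |(H N ω).det| * Real.exp (-(N * ∫ x, Real.log |x| ∂(μ N)))

lemma normDet_nonneg (N : ℕ) (ω : Ω N) : 0 ≤ normDet H μ N ω := by
  unfold normDet; positivity

variable [mΩ : ∀ N, MeasurableSpace (Ω N)] {P : ∀ N, Measure (Ω N)}

lemma exists_truncation_scale [∀ N, IsProbabilityMeasure (P N)]
    (h : ConcentratedInput κ P H μ) (hκ : 0 < κ) :
    ∃ τ : ℝ, 0 < τ ∧ τ ≤ κ / 2 ∧ τ ≤ 1 / 4 ∧ ∀ p δ : ℝ, 0 < δ →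
      ∀ᶠ N : ℕ in atTop, ∀ t, δ ≤ t →
        P N {ω | t < |fluct (P N) (H N) (truncLog ((N : ℝ) ^ (-τ))) ω|}
          ≤ ENNReal.ofReal (Real.exp (-(2 * (p * N) * t))) := by
  obtain ⟨r, hr, hconc⟩ := h.concentration
  have he : 0 < min r 1 := lt_min hr one_pos
  obtain ⟨c, hc, hconc⟩ := hconc (min r 1 / 4) (by positivity)
  refine ⟨min (κ / 2) (min r 1 / 4), by positivity, min_le_left _ _,
    (min_le_right _ _).trans (by linarith [min_le_right r 1]), fun p δ hδ => ?_⟩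
  set τ := min (κ / 2) (min r 1 / 4)
  filter_upwards [eventually_superlinear_threshold (p := p) hc hδ hr
    (min_le_right (κ / 2) (min r 1 / 4)), eventually_ge_atTop 1] with N hth hN t ht
  have hN0 : (0 : ℝ) < N := by exact_mod_cast hN
  have hlip := truncLog_lipschitz (s := (N : ℝ) ^ (-τ)) (by positivity)
  rw [Real.rpow_neg hN0.le, inv_inv] at hlip
  rw [Real.rpow_neg hN0.le]
  exact measure_fluct_le hN (by positivity) (by positivity) hr
    (hconc N hN _ _ (by positivity) hlip) hth.1 hth.2 ht

lemma eventually_abs_meanTruncLog_sub_le [∀ N, IsProbabilityMeasure (P N)]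
    [∀ N, IsProbabilityMeasure (μ N)] (h : ConcentratedInput κ P H μ) (hκ : 0 < κ)
    {τ δ : ℝ} (hτ : 0 < τ) (hτκ : τ ≤ κ / 2) (hδ : 0 < δ) :
    ∀ᶠ N : ℕ in atTop,
      |meanTruncLog P H N ((N : ℝ) ^ (-τ)) - ∫ x, Real.log |x| ∂(μ N)| ≤ δ := by
  have := h.tendsto_rpow_mul_meanTruncLog_sub hκ (ε := 0) (A := 1) hτ (by linarith)
    (by positivity) one_pos
  simp only [Real.rpow_zero, one_mul] at this
  exact this.eventually_le_const hδ

lemma measurable_normDet (h : ConcentratedInput κ P H μ) (N : ℕ) :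
    Measurable (normDet H μ N) := by
  have : Measurable fun ω => (H N ω).det := by
    simp only [Matrix.det_apply]
    refine Finset.measurable_sum _ fun σ _ => Measurable.const_smul ?_ _
    exact Finset.measurable_prod _ fun a _ => h.measurable_entry N _ _
  exact (measurable_abs.comp this).mul_const _

lemma sum_truncLog_eq {N : ℕ} (hN : 1 ≤ N) (s : ℝ) (ω : Ω N) :
    ∑ a, truncLog s (eigs (H N ω) a) =
      N * (fluct (P N) (H N) (truncLog s) ω + meanTruncLog P H N s) := by
  have hN0 : (N : ℝ) ≠ 0 := by positivity
  simp only [fluct, meanTruncLog]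
  field_simp
  ring

lemma normDet_le (h : ConcentratedInput κ P H μ) {N : ℕ} (hN : 1 ≤ N) {s : ℝ} (hs : 0 < s)
    (ω : Ω N) : normDet H μ N ω ≤ Real.exp (N * (fluct (P N) (H N) (truncLog s) ω +
      (meanTruncLog P H N s - ∫ x, Real.log |x| ∂(μ N)))) := by
  have hdet : |(H N ω).det| ≤ Real.exp (∑ a, truncLog s (eigs (H N ω) a)) := by
    rw [det_eq_prod_eigs (h.isHermitian N ω), Finset.abs_prod, Real.exp_sum]
    refine Finset.prod_le_prod (fun _ _ => abs_nonneg _) fun a _ => ?_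
    rw [truncLog, Real.exp_log (lt_max_of_lt_right hs)]
    exact le_max_left _ _
  rw [sum_truncLog_eq (P := P) hN] at hdet
  refine (mul_le_mul_of_nonneg_right hdet (Real.exp_pos _).le).trans_eq ?_
  rw [← Real.exp_add]
  congr 1
  ring

/-- Moments of the normalized determinant are at most subexponentially large. -/
lemma eventually_lintegral_normDet_pow_le [∀ N, IsProbabilityMeasure (P N)]
    [∀ N, IsProbabilityMeasure (μ N)] (h : ConcentratedInput κ P H μ) (hκ : 0 < κ)
    {p : ℕ} (hp : 1 ≤ p) {δ : ℝ} (hδ : 0 < δ) :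
    ∀ᶠ N : ℕ in atTop, ∫⁻ ω, ENNReal.ofReal (normDet H μ N ω ^ p) ∂(P N) ≤
      ENNReal.ofReal (Real.exp (δ * N)) := by
  obtain ⟨τ, hτ, hτκ, -, htail⟩ := h.exists_truncation_scale hκ
  have hp0 : (0 : ℝ) < p := by exact_mod_cast hp
  have hδ3 : 0 < δ / (3 * p) := by positivity
  filter_upwards [htail p _ hδ3, h.eventually_abs_meanTruncLog_sub_le hκ hτ hτκ hδ3,
    (tendsto_exp_neg_natCast_mul (b := δ / 3) (by positivity)).eventually_le_const
      (by norm_num : (0 : ℝ) < 1 / 2), eventually_ge_atTop 1] with N ht hm hexp hN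
  have hN0 : (0 : ℝ) < N := by exact_mod_cast hN
  set s := (N : ℝ) ^ (-τ)
  have hs : 0 < s := by positivity
  set F := fluct (P N) (H N) (truncLog s)
  have hF : Measurable F := measurable_fluct (h.measurable_entry N) (h.isHermitian N)
    (continuous_of_abs_sub_le (truncLog_lipschitz hs))
  have hpt : ∀ ω, normDet H μ N ω ^ p ≤ Real.exp (δ / 3 * N) * Real.exp (p * N * |F ω|) := by
    intro ω
    refine (pow_le_pow_left₀ (normDet_nonneg _ _) (h.normDet_le hN hs ω) p).trans ?_
    rw [← Real.exp_nat_mul, ← Real.exp_add]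
    refine Real.exp_le_exp.2 ?_
    have h1 : F ω + (meanTruncLog P H N s - ∫ x, Real.log |x| ∂(μ N)) ≤
        |F ω| + δ / (3 * p) := add_le_add (le_abs_self _) ((le_abs_self _).trans hm)
    calc (p : ℝ) * (N * (F ω + (meanTruncLog P H N s - ∫ x, Real.log |x| ∂(μ N))))
        ≤ p * (N * (|F ω| + δ / (3 * p))) := by gcongr
      _ = δ / 3 * N + p * N * |F ω| := by field_simp; ring
  have hq : (p : ℝ) * N * (δ / (3 * p)) = δ / 3 * N := by field_simp
  have hmom := lintegral_exp_le_of_tail (P := P N) hF (q := p * N) (by positivity) hδ3 ht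
  rw [hq] at hmom
  have hinv : (1 - ENNReal.ofReal (Real.exp (-(δ / 3 * N))))⁻¹ ≤ ENNReal.ofReal 2 := by
    rw [← ENNReal.ofReal_one, ← ENNReal.ofReal_sub _ (Real.exp_pos _).le,
      ← ENNReal.ofReal_inv_of_pos (by linarith)]
    refine ENNReal.ofReal_le_ofReal ?_
    rw [inv_le_comm₀ (by linarith) two_pos]
    linarith
  have hy : 2 ≤ Real.exp (δ / 3 * N) := by
    rw [Real.exp_neg, inv_le_comm₀ (Real.exp_pos _) (by norm_num)] at hexp
    simpa using hexp
  calc ∫⁻ ω, ENNReal.ofReal (normDet H μ N ω ^ p) ∂(P N)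
      ≤ ∫⁻ ω, ENNReal.ofReal (Real.exp (δ / 3 * N)) *
          ENNReal.ofReal (Real.exp (p * N * |F ω|)) ∂(P N) := by
        refine lintegral_mono fun ω => ?_
        rw [← ENNReal.ofReal_mul (Real.exp_pos _).le]
        exact ENNReal.ofReal_le_ofReal (hpt ω)
    _ = ENNReal.ofReal (Real.exp (δ / 3 * N)) *
          ∫⁻ ω, ENNReal.ofReal (Real.exp (p * N * |F ω|)) ∂(P N) :=
        lintegral_const_mul _ (by fun_prop)
    _ ≤ ENNReal.ofReal (Real.exp (δ / 3 * N)) *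
          (ENNReal.ofReal (Real.exp (δ / 3 * N)) + ENNReal.ofReal 2) := by
        gcongr
        exact hmom.trans (by gcongr)
    _ ≤ ENNReal.ofReal (Real.exp (δ * N)) := by
        rw [← ENNReal.ofReal_add (Real.exp_pos _).le two_pos.le,
          ← ENNReal.ofReal_mul (Real.exp_pos _).le]
        refine ENNReal.ofReal_le_ofReal ?_
        rw [show δ * N = (3 : ℕ) * (δ / 3 * N) by push_cast; ring, Real.exp_nat_mul]
        nlinarith [mul_nonneg (sub_nonneg.2 hy) (Real.exp_pos (δ / 3 * N)).le,
          mul_nonneg (mul_nonneg (sub_nonneg.2 hy) (Real.exp_pos (δ / 3 * N)).le)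
            (Real.exp_pos (δ / 3 * N)).le]

lemma tendsto_measure_gap_fails [∀ N, IsProbabilityMeasure (P N)]
    (h : ConcentratedInput κ P H μ) {ε : ℝ} (hε : 0 < ε) :
    Tendsto (fun N : ℕ => P N {ω | ∀ a, eigs (H N ω) a ∉
      Set.Icc (-(Real.exp (-(N : ℝ) ^ ε))) (Real.exp (-(N : ℝ) ^ ε))}ᶜ) atTop (nhds 0) := by
  have hlim : Tendsto (fun N : ℕ => 1 - P N {ω | ∀ a, eigs (H N ω) a ∉
      Set.Icc (-(Real.exp (-(N : ℝ) ^ ε))) (Real.exp (-(N : ℝ) ^ ε))}) atTop (nhds 0) := by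
    have h1 := ENNReal.tendsto_ofReal (h.gap ε hε)
    simp only [ENNReal.ofReal_toReal (measure_ne_top _ _), ENNReal.ofReal_one] at h1
    simpa using ENNReal.Tendsto.sub tendsto_const_nhds h1 (Or.inl ENNReal.one_ne_top)
  refine hlim.congr' ?_
  filter_upwards [eventually_ge_atTop 1] with N hN
  refine (prob_compl_eq_one_sub ?_).symm
  set I := Set.Icc (-(Real.exp (-(N : ℝ) ^ ε))) (Real.exp (-(N : ℝ) ^ ε))
  have hm := measurable_empSpec hN (h.measurable_entry N) (h.isHermitian N)
  have hset : {ω | ∀ a, eigs (H N ω) a ∉ I} = (fun ω => empSpec (H N ω) I) ⁻¹' {0} := by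
    ext ω
    simp [empSpec]
  rw [hset]
  exact (Measure.measurable_coe measurableSet_Icc).comp hm (measurableSet_singleton 0)

lemma normDet_ge (h : ConcentratedInput κ P H μ) {N : ℕ} (hN : 1 ≤ N) {s y : ℝ} (hs : 0 < s)
    (hs1 : s ≤ 1) (hy : 0 ≤ y) {ω : Ω N}
    (hgap : ∀ a, eigs (H N ω) a ∉ Set.Icc (-Real.exp (-y)) (Real.exp (-y))) :
    Real.exp (N * (fluct (P N) (H N) (truncLog s) ω +
      (meanTruncLog P H N s - ∫ x, Real.log |x| ∂(μ N))) -
      y * ∑ a, (truncLog (Real.exp 1 * s) (eigs (H N ω) a) - truncLog s (eigs (H N ω) a)))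
      ≤ normDet H μ N ω := by
  have hne : ∀ a, eigs (H N ω) a ≠ 0 := fun a h0 => hgap a (by
    rw [h0]; exact ⟨by simp [(Real.exp_pos _).le], (Real.exp_pos _).le⟩)
  have hdet : |(H N ω).det| = Real.exp (∑ a, Real.log |eigs (H N ω) a|) := by
    rw [det_eq_prod_eigs (h.isHermitian N ω), Finset.abs_prod, Real.exp_sum]
    exact Finset.prod_congr rfl fun a _ => (Real.exp_log (abs_pos.2 (hne a))).symm
  rw [normDet, hdet, ← Real.exp_add]
  refine Real.exp_le_exp.2 ?_
  have hsum := Finset.sum_le_sum fun a (_ : a ∈ Finset.univ) =>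
    truncLog_sub_le_log_abs hs hs1 hy (hgap a)
  rw [Finset.sum_sub_distrib, sum_truncLog_eq (P := P) hN, ← Finset.mul_sum] at hsum
  linarith

lemma tendsto_measure_small_eigs [∀ N, IsProbabilityMeasure (P N)]
    [∀ N, IsProbabilityMeasure (μ N)] (h : ConcentratedInput κ P H μ) (hκ : 0 < κ)
    {τ ε δ : ℝ} (hτ : 0 < τ) (hε : ε < κ - τ) (hε' : ε < τ * (κ / 2)) (hδ : 0 < δ) :
    Tendsto (fun N : ℕ => P N {ω | δ * N ≤ (N : ℝ) ^ ε *
      ∑ a, (truncLog (Real.exp 1 * (N : ℝ) ^ (-τ)) (eigs (H N ω) a) -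
        truncLog ((N : ℝ) ^ (-τ)) (eigs (H N ω) a))}) atTop (nhds 0) := by
  have h1 := h.tendsto_rpow_mul_meanTruncLog_sub hκ hτ hε hε' one_pos
  have h2 := h.tendsto_rpow_mul_meanTruncLog_sub hκ hτ hε hε' (Real.exp_pos 1)
  have hlim := ENNReal.tendsto_ofReal ((h2.add h1).const_mul δ⁻¹)
  simp only [one_mul, add_zero, mul_zero, ENNReal.ofReal_zero] at hlim
  refine tendsto_of_tendsto_of_tendsto_of_le_of_le' tendsto_const_nhds hlim
    (Eventually.of_forall fun _ => zero_le) ?_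
  filter_upwards [eventually_ge_atTop 1] with N hN
  have hN0 : (0 : ℝ) < N := by exact_mod_cast hN
  set s := (N : ℝ) ^ (-τ)
  have hs : 0 < s := by positivity
  have hes : s ≤ Real.exp 1 * s := le_mul_of_one_le_left hs.le (Real.one_le_exp zero_le_one)
  have hi1 := h.integrable_sum_eigs hN (inv_pos.2 hs) (truncLog_lipschitz hs)
  have hes0 : 0 < Real.exp 1 * s := by positivity
  have hi2 := h.integrable_sum_eigs hN (inv_pos.2 hes0) (truncLog_lipschitz hes0)
  simp only [Finset.sum_sub_distrib]
  set G := fun ω => (N : ℝ) ^ ε * (∑ a, truncLog (Real.exp 1 * s) (eigs (H N ω) a) -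
    ∑ a, truncLog s (eigs (H N ω) a)) with hG
  have hGi : Integrable G (P N) := (hi2.sub hi1).const_mul _
  have hG0 : ∀ ω, 0 ≤ G ω := fun ω => mul_nonneg (by positivity) (sub_nonneg.2
    (Finset.sum_le_sum fun a _ => Real.log_le_log (lt_max_of_lt_right hs) (max_le_max le_rfl hes)))
  have hmarkov := mul_meas_ge_le_integral_of_nonneg (ae_of_all _ hG0) hGi (δ * N)
  rw [hG, integral_const_mul, integral_sub hi2 hi1] at hmarkov
  rw [← ENNReal.ofReal_toReal (measure_ne_top (P N) _)]
  refine ENNReal.ofReal_le_ofReal ?_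
  set m := ∫ x, Real.log |x| ∂(μ N)
  have hm : ∀ s, ∫ ω, ∑ a, truncLog s (eigs (H N ω) a) ∂(P N) = N * meanTruncLog P H N s := by
    intro s
    rw [meanTruncLog]
    field_simp
  rw [hm, hm] at hmarkov
  rw [le_inv_mul_iff₀ hδ]
  refine le_of_mul_le_mul_left ?_ hN0
  calc (N : ℝ) * (δ * (P N {ω | δ * N ≤ G ω}).toReal)
      = δ * N * (P N).real {ω | δ * N ≤ G ω} := by rw [Measure.real]; ring
    _ ≤ _ := hmarkov
    _ = N * ((N : ℝ) ^ ε * ((meanTruncLog P H N (Real.exp 1 * s) - m) -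
          (meanTruncLog P H N s - m))) := by ring
    _ ≤ N * ((N : ℝ) ^ ε * (|meanTruncLog P H N (Real.exp 1 * s) - m| +
          |meanTruncLog P H N s - m|)) := by
        gcongr
        linarith [le_abs_self (meanTruncLog P H N (Real.exp 1 * s) - m),
          neg_abs_le (meanTruncLog P H N s - m)]
    _ = _ := by ring

/-- With high probability, the normalized determinant is not exponentially small. -/
lemma tendsto_measure_normDet_lt [∀ N, IsProbabilityMeasure (P N)]
    [∀ N, IsProbabilityMeasure (μ N)] (h : ConcentratedInput κ P H μ) (hκ : 0 < κ)
    {δ : ℝ} (hδ : 0 < δ) :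
    Tendsto (fun N : ℕ => P N {ω | normDet H μ N ω < Real.exp (-(δ * N))}) atTop (nhds 0) := by
  obtain ⟨τ, hτ, hτκ, hτ4, htail⟩ := h.exists_truncation_scale hκ
  set ε := τ * κ / 4
  have hε : 0 < ε := by positivity
  have hε1 : ε < κ - τ := by simp only [ε]; nlinarith
  have hε2 : ε < τ * (κ / 2) := by simp only [ε]; nlinarith [mul_pos hτ hκ]
  have hδ3 : 0 < δ / 3 := by positivity
  have hexp := ENNReal.tendsto_ofReal (tendsto_exp_neg_natCast_mul (b := 2 * (δ / 3))
    (by positivity))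
  rw [ENNReal.ofReal_zero] at hexp
  have hlim := ((h.tendsto_measure_gap_fails hε).add hexp).add
    (h.tendsto_measure_small_eigs hκ hτ hε1 hε2 hδ3)
  simp only [add_zero] at hlim
  refine tendsto_of_tendsto_of_tendsto_of_le_of_le' tendsto_const_nhds hlim
    (Eventually.of_forall fun _ => zero_le) ?_
  filter_upwards [htail 1 _ hδ3, h.eventually_abs_meanTruncLog_sub_le hκ hτ hτκ hδ3,
    eventually_ge_atTop 1] with N ht hm hN
  have hN0 : (0 : ℝ) < N := by exact_mod_cast hN
  have hs1 : (N : ℝ) ^ (-τ) ≤ 1 :=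
    Real.rpow_le_one_of_one_le_of_nonpos (by exact_mod_cast hN) (by linarith)
  have ht' := ht _ le_rfl
  rw [show 2 * (1 * (N : ℝ)) * (δ / 3) = 2 * (δ / 3) * N by ring] at ht'
  refine le_trans ?_ (add_le_add (add_le_add le_rfl ht') le_rfl)
  refine le_trans (measure_mono ?_) ((measure_union_le _ _).trans
    (add_le_add (measure_union_le _ _) le_rfl))
  intro ω hω
  by_contra hcon
  simp only [Set.mem_union, not_or, Set.notMem_compl_iff] at hcon
  obtain ⟨⟨hgap, hfl⟩, hsm⟩ := hcon
  simp only [Set.mem_ofPred_eq, not_lt, not_le] at hgap hfl hsm hω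
  refine absurd hω (not_lt.2 (le_trans (Real.exp_le_exp.2 ?_)
    (h.normDet_ge hN (by positivity) hs1 (by positivity) hgap)))
  have h1 := (abs_le.1 hfl).1
  have h2 := (abs_le.1 hm).1
  nlinarith [mul_nonneg hN0.le (sub_nonneg.2 h1), mul_nonneg hN0.le (sub_nonneg.2 h2)]

end ConcentratedInput

lemma prod_le_one_add_sum_pow {ℓ : ℕ} (D : Fin ℓ → ℝ) (hD : ∀ i, 0 ≤ D i) :
    ∏ i, D i ≤ 1 + ∑ i, D i ^ ℓ := by
  rcases isEmpty_or_nonempty (Fin ℓ) with hℓ | hℓ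
  · simp
  obtain ⟨j, hj⟩ := Finite.exists_max D
  calc ∏ i, D i ≤ ∏ _i : Fin ℓ, D j := Finset.prod_le_prod (fun i _ => hD i) fun i _ => hj i
    _ = D j ^ ℓ := by simp
    _ ≤ ∑ i, D i ^ ℓ := Finset.single_le_sum (f := fun i => D i ^ ℓ)
        (fun i _ => pow_nonneg (hD i) ℓ) (Finset.mem_univ j)
    _ ≤ 1 + ∑ i, D i ^ ℓ := by linarith

lemma tendsto_inv_mul_log_of_exp_bounds {W : ℕ → ℝ} {a b C : ℝ} (ha : 0 < a) (hb : 0 < b)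
    (h : ∀ δ : ℝ, 0 < δ → ∀ᶠ N : ℕ in atTop,
      a * Real.exp (-(C * δ * N)) ≤ W N ∧ W N ≤ b * Real.exp (δ * N)) :
    Tendsto (fun N : ℕ => (N : ℝ)⁻¹ * Real.log (W N)) atTop (nhds 0) := by
  refine Metric.tendsto_nhds.2 fun η hη => ?_
  set δ := η / (2 * (|C| + 1)) with hδ
  have hC : 0 < |C| + 1 := by positivity
  have hδ0 : 0 < δ := by positivity
  have hCδ : |C| * δ + δ = η / 2 := by rw [hδ]; field_simp
  have hCδ' : C * δ ≤ |C| * δ := by gcongr; exact le_abs_self C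
  have hC0 : 0 ≤ |C| * δ := by positivity
  have hη2 : 0 < η / 2 := by positivity
  have hlarge := tendsto_natCast_atTop_atTop (R := ℝ).const_mul_atTop hη2
  filter_upwards [h δ hδ0, hlarge.eventually_gt_atTop (-Real.log a),
    hlarge.eventually_gt_atTop (Real.log b), eventually_gt_atTop 0] with N ⟨h1, h2⟩ h3 h4 hN
  have hN0 : (0 : ℝ) < N := by exact_mod_cast hN
  have hW : 0 < W N := lt_of_lt_of_le (by positivity) h1
  have hlow := Real.log_le_log (by positivity) h1
  have hup := Real.log_le_log hW h2
  rw [Real.log_mul ha.ne' (Real.exp_pos _).ne', Real.log_exp] at hlow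
  rw [Real.log_mul hb.ne' (Real.exp_pos _).ne', Real.log_exp] at hup
  have h5 : C * δ * N ≤ η / 2 * N := by gcongr; linarith
  have h6 : δ * N ≤ η / 2 * N := by gcongr; linarith
  rw [Real.dist_eq, sub_zero, abs_lt, ← mul_lt_mul_iff_right₀ hN0,
    ← mul_lt_mul_iff_right₀ hN0 (b := (N : ℝ)⁻¹ * _), mul_inv_cancel_left₀ hN0.ne']
  constructor <;> nlinarith

namespace ConcentratedInput

variable {κ : ℝ} {Ω : ℕ → Type*} [mΩ : ∀ N, MeasurableSpace (Ω N)]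
  {P : ∀ N, Measure (Ω N)} {ℓ : ℕ} {H : Fin ℓ → ∀ N : ℕ, Ω N → Matrix (Fin N) (Fin N) ℝ}
  {μ : Fin ℓ → ℕ → Measure ℝ}

lemma eventually_lintegral_prod_normDet_le [∀ N, IsProbabilityMeasure (P N)]
    [∀ i N, IsProbabilityMeasure (μ i N)] (h : ∀ i, ConcentratedInput κ P (H i) (μ i))
    (hκ : 0 < κ) {δ : ℝ} (hδ : 0 < δ) :
    ∀ᶠ N : ℕ in atTop, ∫⁻ ω, ENNReal.ofReal (∏ i, normDet (H i) (μ i) N ω) ∂(P N) ≤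
      ENNReal.ofReal ((ℓ + 1) * Real.exp (δ * N)) := by
  have hmom : ∀ᶠ N : ℕ in atTop, ∀ i,
      ∫⁻ ω, ENNReal.ofReal (normDet (H i) (μ i) N ω ^ ℓ) ∂(P N) ≤
        ENNReal.ofReal (Real.exp (δ * N)) :=
    eventually_all.2 fun i => (h i).eventually_lintegral_normDet_pow_le hκ i.pos hδ
  filter_upwards [hmom] with N hN
  have hmeas : ∀ i, Measurable fun ω => ENNReal.ofReal (normDet (H i) (μ i) N ω ^ ℓ) :=
    fun i => (((h i).measurable_normDet N).pow_const ℓ).ennreal_ofReal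
  calc ∫⁻ ω, ENNReal.ofReal (∏ i, normDet (H i) (μ i) N ω) ∂(P N)
      ≤ ∫⁻ ω, (1 + ∑ i, ENNReal.ofReal (normDet (H i) (μ i) N ω ^ ℓ)) ∂(P N) := by
        refine lintegral_mono fun ω => ?_
        have hnn : ∀ i, 0 ≤ normDet (H i) (μ i) N ω := fun i => normDet_nonneg N ω
        rw [← ENNReal.ofReal_one, ← ENNReal.ofReal_sum_of_nonneg fun i _ => pow_nonneg (hnn i) ℓ,
          ← ENNReal.ofReal_add zero_le_one (Finset.sum_nonneg fun i _ => pow_nonneg (hnn i) ℓ)]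
        exact ENNReal.ofReal_le_ofReal (prod_le_one_add_sum_pow _ hnn)
    _ = 1 + ∑ i, ∫⁻ ω, ENNReal.ofReal (normDet (H i) (μ i) N ω ^ ℓ) ∂(P N) := by
        rw [lintegral_add_left measurable_const, lintegral_finsetSum _ fun i _ => hmeas i]
        simp
    _ ≤ 1 + ∑ _i : Fin ℓ, ENNReal.ofReal (Real.exp (δ * N)) := by
        gcongr with i
        exact hN i
    _ ≤ ENNReal.ofReal ((ℓ + 1) * Real.exp (δ * N)) := by
        have h1 : (1 : ℝ) ≤ Real.exp (δ * N) := Real.one_le_exp (by positivity)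
        rw [Finset.sum_const, Finset.card_univ, Fintype.card_fin, nsmul_eq_mul,
          ← ENNReal.ofReal_natCast, ← ENNReal.ofReal_mul (by positivity), ← ENNReal.ofReal_one,
          ← ENNReal.ofReal_add zero_le_one (by positivity)]
        exact ENNReal.ofReal_le_ofReal (by linarith)

lemma eventually_le_lintegral_prod_normDet [∀ N, IsProbabilityMeasure (P N)]
    [∀ i N, IsProbabilityMeasure (μ i N)] (h : ∀ i, ConcentratedInput κ P (H i) (μ i))
    (hκ : 0 < κ) {δ : ℝ} (hδ : 0 < δ) :
    ∀ᶠ N : ℕ in atTop, ENNReal.ofReal (2⁻¹ * Real.exp (-(ℓ * δ * N))) ≤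
      ∫⁻ ω, ENNReal.ofReal (∏ i, normDet (H i) (μ i) N ω) ∂(P N) := by
  have hbad : Tendsto (fun N : ℕ => ∑ i, P N {ω | normDet (H i) (μ i) N ω < Real.exp (-(δ * N))})
      atTop (nhds 0) := by
    simpa using tendsto_finsetSum Finset.univ fun i _ => (h i).tendsto_measure_normDet_lt hκ hδ
  filter_upwards [hbad.eventually_le_const (by simp : (0 : ℝ≥0∞) < 2⁻¹)] with N hN
  set B := ⋃ i, {ω | normDet (H i) (μ i) N ω < Real.exp (-(δ * N))}
  have hB : MeasurableSet B := MeasurableSet.iUnion fun i =>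
    measurableSet_lt ((h i).measurable_normDet N) measurable_const
  have hPB : P N B ≤ 2⁻¹ := ((measure_iUnion_fintype_le _ _).trans hN)
  have hPBc : 2⁻¹ ≤ P N Bᶜ := by
    rw [prob_compl_eq_one_sub hB, ← ENNReal.one_sub_inv_two]
    exact tsub_le_tsub_left hPB 1
  have hsub : Bᶜ ⊆ {ω | ENNReal.ofReal (Real.exp (-(ℓ * δ * N))) ≤
      ENNReal.ofReal (∏ i, normDet (H i) (μ i) N ω)} := by
    intro ω hω
    simp only [B, Set.mem_compl_iff, Set.mem_iUnion, Set.mem_ofPred_eq, not_exists, not_lt] at hω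
    refine ENNReal.ofReal_le_ofReal ?_
    calc Real.exp (-(ℓ * δ * N)) = ∏ _i : Fin ℓ, Real.exp (-(δ * N)) := by
          rw [Finset.prod_const, Finset.card_univ, Fintype.card_fin, ← Real.exp_nat_mul]
          congr 1
          ring
      _ ≤ _ := Finset.prod_le_prod (fun _ _ => (Real.exp_pos _).le) fun i _ => hω i
  have hmeas : Measurable fun ω => ENNReal.ofReal (∏ i, normDet (H i) (μ i) N ω) :=
    (Finset.measurable_prod _ fun i _ => (h i).measurable_normDet N).ennreal_ofReal
  refine le_trans ?_ (mul_meas_ge_le_lintegral hmeas (ENNReal.ofReal (Real.exp (-(ℓ * δ * N)))))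
  rw [mul_comm, ENNReal.ofReal_mul (Real.exp_pos _).le, ENNReal.ofReal_inv_of_pos two_pos,
    ENNReal.ofReal_ofNat]
  exact mul_le_mul_right (hPBc.trans (measure_mono hsub)) _

lemma tendsto_log_lintegral_prod_normDet [∀ N, IsProbabilityMeasure (P N)]
    [∀ i N, IsProbabilityMeasure (μ i N)] (h : ∀ i, ConcentratedInput κ P (H i) (μ i))
    (hκ : 0 < κ) :
    Tendsto (fun N : ℕ => (N : ℝ)⁻¹ * Real.log
      (∫⁻ ω, ENNReal.ofReal (∏ i, normDet (H i) (μ i) N ω) ∂(P N)).toReal) atTop (nhds 0) := by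
  refine tendsto_inv_mul_log_of_exp_bounds (a := 2⁻¹) (b := ℓ + 1) (C := ℓ) (by norm_num)
    (by positivity) fun δ hδ => ?_
  filter_upwards [eventually_lintegral_prod_normDet_le h hκ hδ,
    eventually_le_lintegral_prod_normDet h hκ hδ] with N hN1 hN2
  exact ⟨(ENNReal.ofReal_le_iff_le_toReal (hN1.trans_lt ENNReal.ofReal_lt_top).ne).1 hN2,
    ENNReal.toReal_le_of_le_ofReal (by positivity) hN1⟩

lemma lintegral_prod_abs_det_eq (P : ∀ N, Measure (Ω N)) (N : ℕ) :
    (∫⁻ ω, ENNReal.ofReal (∏ i, |(H i N ω).det|) ∂(P N)).toReal =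
      Real.exp (N * ∑ i, ∫ x, Real.log |x| ∂(μ i N)) *
        (∫⁻ ω, ENNReal.ofReal (∏ i, normDet (H i) (μ i) N ω) ∂(P N)).toReal := by
  rw [← ENNReal.toReal_ofReal (Real.exp_pos (N * ∑ i, ∫ x, Real.log |x| ∂(μ i N))).le,
    ← ENNReal.toReal_mul, ← lintegral_const_mul' _ _ ENNReal.ofReal_ne_top]
  congr 2
  ext ω
  rw [← ENNReal.ofReal_mul (Real.exp_pos _).le]
  simp only [normDet]
  rw [Finset.prod_mul_distrib, ← Real.exp_sum, Finset.sum_neg_distrib, ← Finset.mul_sum,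
    Real.exp_neg, mul_left_comm, mul_inv_cancel₀ (Real.exp_pos _).ne', mul_one]

end ConcentratedInput

/-- **Concentrated inputs, products of determinants.** If each of `ℓ` (arbitrarily
correlated) sequences of random symmetric matrices satisfies the assumptions of the
concentrated-input theorem, then
`(1/N) log E[∏ᵢ |det H_N^{(i)}|] − Σᵢ ∫ log|λ| μ_N^{(i)}(dλ) → 0`. -/
theorem concentrated_inputs_products
    (ℓ : ℕ) (κ : ℝ) (hκ : 0 < κ)
    (Ω : ℕ → Type*) (mΩ : ∀ N, MeasurableSpace (Ω N))
    (P : ∀ N, Measure (Ω N)) (hP : ∀ N, IsProbabilityMeasure (P N))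
    (H : Fin ℓ → ∀ N : ℕ, Ω N → Matrix (Fin N) (Fin N) ℝ)
    (hmeas : ∀ i N, ∀ a b, Measurable fun ω => H i N ω a b)
    (hsymm : ∀ i N ω, (H i N ω).IsHermitian)
    (μ : Fin ℓ → ℕ → Measure ℝ) (hμprob : ∀ i N, IsProbabilityMeasure (μ i N))
    -- (W) Wasserstein-1 approximation:
    (hW1 : ∀ i, ∀ N : ℕ, 1 ≤ N → W1 (meanSpec (P N) (H i N)) (μ i N) ≤ (N : ℝ) ^ (-κ))
    -- common compact support:
    (hsupp : ∀ i, ∃ R : ℝ, 0 < R ∧ ∀ N, (μ i N) (Set.Icc (-R) R)ᶜ = 0)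
    -- density `μ_N^{(i)}(x)` bounded by `κ⁻¹ |x|^{−1+κ}` on `(−κ, κ)`:
    (hdens : ∀ i, ∃ ρ : ℕ → ℝ → ℝ,
      (∀ N, ∀ s ⊆ Set.Ioo (-κ) κ, MeasurableSet s →
        μ i N s = ∫⁻ x in s, ENNReal.ofReal (ρ N x) ∂MeasureTheory.volume) ∧
      (∀ N, ∀ x : ℝ, |x| < κ → ρ N x < κ⁻¹ * |x| ^ (-1 + κ)))
    -- (L) concentration for Lipschitz traces:
    (hLip : ∀ i : Fin ℓ, ∃ ε₀ : ℝ, 0 < ε₀ ∧ ∀ ζ : ℝ, 0 < ζ → ∃ c : ℝ, 0 < c ∧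
      ∀ N : ℕ, 1 ≤ N → ∀ f : ℝ → ℝ, ∀ L : ℝ, 0 < L →
        (∀ x y, |f x - f y| ≤ L * |x - y|) → ∀ δ : ℝ, 0 < δ →
        (P N {ω | δ < |(N : ℝ)⁻¹ * (∑ a, f (eigs (H i N ω) a))
            - (N : ℝ)⁻¹ * ∫ ω', (∑ a, f (eigs (H i N ω') a)) ∂(P N)|}).toReal
          ≤ Real.exp (-(c / (N : ℝ) ^ ζ) *
              min (((N : ℝ) * δ / L) ^ (2 : ℝ)) (((N : ℝ) * δ / L) ^ (1 + ε₀))))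
    -- Wegner-type gap condition:
    (hgap : ∀ i : Fin ℓ, ∀ ε : ℝ, 0 < ε →
      Tendsto (fun N : ℕ =>
          (P N {ω | ∀ a, eigs (H i N ω) a ∉
              Set.Icc (-(Real.exp (-(N : ℝ) ^ ε))) (Real.exp (-(N : ℝ) ^ ε))}).toReal)
        atTop (nhds 1)) :
    Tendsto (fun N : ℕ =>
        (N : ℝ)⁻¹ * Real.log
            (∫⁻ ω, ENNReal.ofReal (∏ i : Fin ℓ, |(H i N ω).det|) ∂(P N)).toReal
          - ∑ i : Fin ℓ, ∫ lam, Real.log |lam| ∂(μ i N))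
      atTop (nhds 0) := by
  have h : ∀ i, ConcentratedInput κ P (H i) (μ i) := fun i =>
    ⟨hmeas i, hsymm i, hW1 i, hsupp i, hdens i, hLip i, hgap i⟩
  have hlim := ConcentratedInput.tendsto_log_lintegral_prod_normDet h hκ
  have hfin := ConcentratedInput.eventually_lintegral_prod_normDet_le h hκ one_pos
  have hpos := ConcentratedInput.eventually_le_lintegral_prod_normDet h hκ one_pos
  refine hlim.congr' ?_
  filter_upwards [hfin, hpos, eventually_gt_atTop 0] with N h1 h2 hN
  have hN0 : (N : ℝ) ≠ 0 := by positivity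
  have hW : (∫⁻ ω, ENNReal.ofReal (∏ i, ConcentratedInput.normDet (H i) (μ i) N ω)
      ∂(P N)).toReal ≠ 0 :=
    (ENNReal.toReal_pos (lt_of_lt_of_le (ENNReal.ofReal_pos.2 (by positivity)) h2).ne'
      (h1.trans_lt ENNReal.ofReal_lt_top).ne).ne'
  rw [ConcentratedInput.lintegral_prod_abs_det_eq (μ := μ), Real.log_mul (Real.exp_pos _).ne' hW,
    Real.log_exp, mul_add, inv_mul_cancel_left₀ hN0, add_sub_cancel_left]
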